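/- Let k, l, m be positive integers with m ≤ k. Then C(P_{2k−1}, P_{2kl+2m−1}) = (2kl+2k−1)/((l+1)(2kl+2m−1)). -/

import Mathlib

open SimpleGraph

/-- The homomorphism density `t(G,T)`. -/
noncomputable def homDensity {α β : Type*} [Fintype α] [Fintype β]
    (G : SimpleGraph α) (T : SimpleGraph β) : ℝ :=
  (Nat.card (G →g T) : ℝ) / (Fintype.card β : ℝ) ^ (Fintype.card α)
/-- The set of real exponents `c ≥ 0` such that `t(G,T) ≥ t(H,T)^c` for all
finite graphs `T` with at least one vertex. -/
def domSet {α β : Type*} [Fintype α] [Fintype β]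
    (G : SimpleGraph α) (H : SimpleGraph β) : Set ℝ :=
  {c : ℝ | 0 ≤ c ∧ ∀ (n : ℕ), 0 < n → ∀ T : SimpleGraph (Fin n),
    homDensity H T ^ c ≤ homDensity G T}

/-- The homomorphism density domination exponent `C(G,H)`, as the infimum of `domSet G H`. -/
noncomputable def domExp {α β : Type*} [Fintype α] [Fintype β]
    (G : SimpleGraph α) (H : SimpleGraph β) : ℝ :=
  sInf (domSet G H)

open Classical in
/-- number of walks of length `a` starting at `v`. -/
noncomputable def wlk {V : Type*} [Fintype V] (T : SimpleGraph V) : ℕ → V → ℝ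
  | 0, _ => 1
  | (a+1), v => ∑ u, if T.Adj v u then wlk T a u else 0

/-- total number of walks of length `a`. -/
noncomputable def totW {V : Type*} [Fintype V] (T : SimpleGraph V) (a : ℕ) : ℝ := ∑ v, wlk T a v

section walks
variable {V : Type*} [Fintype V] (T : SimpleGraph V)

open Classical in
lemma wlk_succ (a : ℕ) (v : V) : wlk T (a+1) v = ∑ u, if T.Adj v u then wlk T a u else 0 := rfl

lemma wlk_nonneg (a : ℕ) : ∀ v, 0 ≤ wlk T a v := by
  induction a with
  | zero => intro v; simp [wlk]
  | succ a ih =>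
    intro v
    rw [wlk_succ]
    exact Finset.sum_nonneg fun u _ => by split_ifs; exacts [ih u, le_rfl]

lemma totW_nonneg (a : ℕ) : 0 ≤ totW T a := Finset.sum_nonneg fun v _ => wlk_nonneg T a v

lemma wlk_ge (a : ℕ) {u v : V} (h : T.Adj u v) : wlk T a v ≤ wlk T (a+1) u := by
  classical
  rw [wlk_succ]
  refine le_trans ?_ (Finset.single_le_sum (f := fun x => if T.Adj u x then wlk T a x else 0)
    (fun x _ => ?_) (Finset.mem_univ v))
  · simp [h]
  · split_ifs; exacts [wlk_nonneg T a x, le_rfl]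

lemma wlk_add (b : ℕ) (a : ℕ) : ∀ v, wlk T (a+b+1) v ≤ wlk T a v * totW T b := by
  classical
  induction a with
  | zero =>
    intro v
    rw [zero_add, wlk_succ]
    simp only [wlk, one_mul, totW]
    exact Finset.sum_le_sum fun u _ => by split_ifs; exacts [le_rfl, wlk_nonneg T b u]
  | succ a ih =>
    intro v
    rw [wlk_succ T a, show a+1+b+1 = (a+b+1)+1 by ring, wlk_succ, Finset.sum_mul]
    exact Finset.sum_le_sum fun u _ => by split_ifs; exacts [ih u, by simp]

lemma totW_add (a b : ℕ) : totW T (a+b+1) ≤ totW T a * totW T b := by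
  rw [totW, totW, Finset.sum_mul]
  exact Finset.sum_le_sum fun v _ => wlk_add T b a v

lemma totW_mul (a l : ℕ) : totW T ((l+1)*(a+1) - 1) ≤ totW T a ^ (l+1) := by
  induction l with
  | zero => simp
  | succ l ih =>
    have : (l+1+1)*(a+1) - 1 = ((l+1)*(a+1) - 1) + a + 1 := by
      have : 0 < (l+1)*(a+1) := by positivity
      have h2 : (l+1+1)*(a+1) = (l+1)*(a+1) + (a+1) := by ring
      omega
    rw [this, pow_succ]
    exact (totW_add T _ _).trans (mul_le_mul_of_nonneg_right ih (totW_nonneg T a))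

open Classical in
/-- weights of edges -/
lemma sum_mul_succ (f : V → ℝ) (b : ℕ) : ∑ u, f u * wlk T (b+1) u =
    ∑ u, ∑ v, if T.Adj u v then f u * wlk T b v else 0 := by
  refine Finset.sum_congr rfl fun u _ => ?_
  rw [wlk_succ, Finset.mul_sum]
  exact Finset.sum_congr rfl fun v _ => by split_ifs <;> simp

open Classical in
lemma sum_succ_mul (f : V → ℝ) (i : ℕ) : ∑ v, wlk T (i+1) v * f v =
    ∑ u, ∑ v, if T.Adj u v then wlk T i u * f v else 0 := by
  rw [Finset.sum_comm]
  refine Finset.sum_congr rfl fun u _ => ?_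
  rw [wlk_succ, Finset.sum_mul]
  exact Finset.sum_congr rfl fun v _ => by simp only [T.adj_comm]; split_ifs <;> simp

lemma pair_eq (i : ℕ) : ∀ b, ∑ u, wlk T i u * wlk T b u = totW T (i+b) := by
  induction i with
  | zero => intro b; simp [wlk, totW]
  | succ i ih =>
    intro b
    rw [sum_succ_mul, ← sum_mul_succ, ih]
    congr 1; ring

open Classical in
lemma pair_edge (i b : ℕ) : (∑ u, ∑ v, if T.Adj u v then wlk T i u * wlk T b v else 0) = totW T (i+b+1) := by
  rw [← sum_mul_succ, pair_eq, add_assoc]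

/-- the telescoping quantity -/
noncomputable def DD (a i : ℕ) : ℝ :=
  ∑ u, wlk T i u * wlk T (a-i) u * (Real.log (wlk T (a-i) u) - Real.log (wlk T i u))

lemma DD_step (i b : ℕ) (hW : 0 < totW T (i+b+1)) (hW2 : 0 < totW T (i+b+1+2)) :
    DD T (i+b+1) i - DD T (i+b+1) (i+1) ≤
      totW T (i+b+1) * Real.log (totW T (i+b+1+2) / totW T (i+b+1)) := by
  classical
  set W := totW T (i+b+1) with hWd
  set W2 := totW T (i+b+1+2) with hW2d
  set R := W2 / W with hR
  have hRpos : 0 < R := div_pos hW2 hW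
  have e1 : DD T (i+b+1) i = ∑ u, ∑ v, if T.Adj u v then
      wlk T i u * (Real.log (wlk T (b+1) u) - Real.log (wlk T i u)) * wlk T b v else 0 := by
    rw [← sum_mul_succ, DD]
    refine Finset.sum_congr rfl fun u _ => ?_
    rw [show i+b+1-i = b+1 by omega]; ring
  have e2 : DD T (i+b+1) (i+1) = ∑ u, ∑ v, if T.Adj u v then
      wlk T i u * (wlk T b v * (Real.log (wlk T b v) - Real.log (wlk T (i+1) v))) else 0 := by
    rw [← sum_succ_mul, DD]
    refine Finset.sum_congr rfl fun u _ => ?_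
    rw [show i+b+1-(i+1) = b by omega]; ring
  have e3 : W * Real.log R = ∑ u, ∑ v, if T.Adj u v then
      (wlk T i u * wlk T b v * (Real.log R - 1) + wlk T (b+1) u * wlk T (i+1) v / R) else 0 := by
    have h1 := pair_edge T i b
    have h2 := pair_edge T (b+1) (i+1)
    have : (∑ u, ∑ v, if T.Adj u v then
      (wlk T i u * wlk T b v * (Real.log R - 1) + wlk T (b+1) u * wlk T (i+1) v / R) else 0)
      = (∑ u, ∑ v, if T.Adj u v then wlk T i u * wlk T b v else 0) * (Real.log R - 1) +
        (∑ u, ∑ v, if T.Adj u v then wlk T (b+1) u * wlk T (i+1) v else 0) / R := by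
      rw [Finset.sum_mul, Finset.sum_div, ← Finset.sum_add_distrib]
      refine Finset.sum_congr rfl fun u _ => ?_
      rw [Finset.sum_mul, Finset.sum_div, ← Finset.sum_add_distrib]
      refine Finset.sum_congr rfl fun v _ => ?_
      split_ifs <;> simp
    rw [this, h1, h2, show b+1+(i+1)+1 = i+b+1+2 by ring, ← hWd, ← hW2d, hR]
    field_simp
    ring
  rw [e1, e2, e3, ← Finset.sum_sub_distrib]
  refine Finset.sum_le_sum fun u _ => ?_
  rw [← Finset.sum_sub_distrib]
  refine Finset.sum_le_sum fun v _ => ?_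
  split_ifs with h
  swap
  · simp
  have n1 := wlk_nonneg T i u
  have n2 := wlk_nonneg T b v
  have n3 := wlk_nonneg T (b+1) u
  have n4 := wlk_nonneg T (i+1) v
  have g1 := wlk_ge T b h
  have g2 := wlk_ge T i h.symm
  rcases n1.eq_or_lt with h1 | h1
  · rw [← h1]; simp; positivity
  rcases n2.eq_or_lt with h2 | h2
  · rw [← h2]; simp; positivity
  have h3 : 0 < wlk T (b+1) u := h2.trans_le g1
  have h4 : 0 < wlk T (i+1) v := h1.trans_le g2
  set x := wlk T i u
  set y := wlk T b v
  set z := wlk T (b+1) u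
  set t := wlk T (i+1) v
  have key := Real.log_le_sub_one_of_pos (show 0 < z * t / (x * y) / R by positivity)
  rw [Real.log_div (by positivity) (by positivity), Real.log_div (by positivity) (by positivity),
    Real.log_mul h3.ne' h4.ne', Real.log_mul h1.ne' h2.ne'] at key
  have key2 := mul_le_mul_of_nonneg_left key (show 0 ≤ x * y by positivity)
  have e : x * y * (z * t / (x * y) / R - 1) = z * t / R - x * y := by field_simp
  rw [e] at key2
  linarith

lemma totW_pos_two (a : ℕ) (hW : 0 < totW T (a+1)) : 0 < totW T (a+1+2) := by
  classical
  have h := pair_edge T 0 a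
  rw [zero_add] at h
  rw [← h] at hW
  obtain ⟨u, _, hu⟩ := Finset.exists_lt_of_sum_lt (s := Finset.univ) (f := fun _ : V => (0:ℝ)) (by simpa using hW)
  obtain ⟨v, _, hv⟩ := Finset.exists_lt_of_sum_lt (s := Finset.univ) (f := fun _ : V => (0:ℝ)) (by simpa using hu)
  split_ifs at hv with hadj
  swap
  · simp at hv
  simp only [wlk, one_mul] at hv
  have h1 := wlk_ge T a hadj
  have h2 := wlk_ge T (a+1) hadj.symm
  have h3 := wlk_ge T (a+2) hadj
  have : wlk T (a+1+2) u ≤ totW T (a+1+2) :=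
    Finset.single_le_sum (fun x _ => wlk_nonneg T _ x) (Finset.mem_univ u)
  have e : a+2+1 = a+1+2 := by ring
  rw [e] at h3
  have e : a+1+1 = a+2 := by ring
  rw [e] at h2
  linarith

lemma walk_ineq (a : ℕ) (hW : 0 < totW T (a+1)) (N : ℝ) (hN : N = Fintype.card V) (hN0 : 0 < N) :
    2 * Real.log (totW T (a+1) / N) ≤ (a+1) * Real.log (totW T (a+1+2) / totW T (a+1)) := by
  have hW2 := totW_pos_two T a hW
  set W := totW T (a+1) with hWd
  set Q := Real.log (totW T (a+1+2) / W) with hQ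
  have tel : ∀ j, j ≤ a+1 → DD T (a+1) 0 - DD T (a+1) j ≤ j * (W * Q) := by
    intro j
    induction j with
    | zero => intro _; simp
    | succ j ih =>
      intro hj
      have h1 := ih (by omega)
      obtain ⟨b, hb⟩ : ∃ b, a = j + b := ⟨a - j, by omega⟩
      have h2 := DD_step T j b (by rw [← hb]; exact hW) (by rw [← hb]; exact hW2)
      rw [← hb] at h2
      push_cast
      linarith
  have h := tel (a+1) le_rfl
  have hs : 2 * (W * Real.log (W / N)) ≤ DD T (a+1) 0 - DD T (a+1) (a+1) := by
    simp only [DD, wlk, Nat.sub_self, Nat.sub_zero, ← Finset.sum_sub_distrib]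
    have : 2 * (W * Real.log (W/N)) = ∑ u, 2 * (wlk T (a+1) u * (Real.log (W/N) + 1) - W / N) := by
      rw [← Finset.mul_sum, Finset.sum_sub_distrib, ← Finset.sum_mul]
      change _ = 2 * (W * _ - _)
      simp only [Finset.sum_const, Finset.card_univ, nsmul_eq_mul, ← hN]
      field_simp; ring
    rw [this]
    refine Finset.sum_le_sum fun u _ => ?_
    change _ ≤ 1 * wlk T (a+1) u * (Real.log (wlk T (a+1) u) - Real.log 1) -
      wlk T (a+1) u * 1 * (Real.log 1 - Real.log (wlk T (a+1) u))
    rw [Real.log_one]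
    rcases (wlk_nonneg T (a+1) u).eq_or_lt with h1 | h1
    · rw [← h1]; simp; positivity
    set x := wlk T (a+1) u
    have key := Real.log_le_sub_one_of_pos (show 0 < W / N / x by positivity)
    rw [Real.log_div (by positivity) (by positivity)] at key
    have key2 := mul_le_mul_of_nonneg_left key h1.le
    have e : x * (W/N/x - 1) = W/N - x := by field_simp
    rw [e] at key2
    linarith
  have : W * (2 * Real.log (W / N)) ≤ W * ((a+1) * Q) := by
    push_cast at h
    linarith
  exact le_of_mul_le_mul_left this hW

/-- normalised number of walks. -/
noncomputable def tW (a : ℕ) : ℝ := totW T a / (Fintype.card V : ℝ)^(a+1)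

lemma tW_nonneg (a : ℕ) : 0 ≤ tW T a := div_nonneg (totW_nonneg T a) (by positivity)

lemma tW_mul (a l : ℕ) : tW T ((l+1)*(a+1) - 1) ≤ tW T a ^ (l+1) := by
  have : 0 < (l+1)*(a+1) := by positivity
  rw [tW, tW, div_pow, ← pow_mul, show (l+1)*(a+1) - 1 + 1 = (a+1)*(l+1) by rw [mul_comm (a+1)]; omega]
  exact div_le_div_of_nonneg_right (totW_mul T a l) (by positivity)

lemma tW_step [Nonempty V] (a : ℕ) :
    tW T (a+1) ^ ((1:ℝ)/((a+1 : ℕ):ℝ)) ≤ tW T (a+1+2) ^ ((1:ℝ)/((a+1+2:ℕ):ℝ)) := by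
  rcases (totW_nonneg T (a+1)).eq_or_lt with h0 | h0
  · rw [tW, ← h0, zero_div, Real.zero_rpow (by positivity)]
    exact Real.rpow_nonneg (tW_nonneg T _) _
  have h2 := totW_pos_two T a h0
  have hN : (0:ℝ) < Fintype.card V := by exact_mod_cast Fintype.card_pos
  have key := walk_ineq T a h0 _ rfl hN
  set N : ℝ := (Fintype.card V : ℝ) with hNd
  have p1 : 0 < tW T (a+1) := by rw [tW]; positivity
  have p2 : 0 < tW T (a+1+2) := by rw [tW]; positivity
  rw [← Real.log_le_log_iff (by positivity) (by positivity), Real.log_rpow p1, Real.log_rpow p2,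
    tW, tW, ← hNd, Real.log_div (by positivity) (by positivity), Real.log_div (by positivity) (by positivity),
    Real.log_pow, Real.log_pow]
  rw [Real.log_div (by positivity) (by positivity), Real.log_div (by positivity) (by positivity)] at key
  push_cast
  rw [one_div_mul_eq_div, one_div_mul_eq_div, div_le_div_iff₀ (by positivity) (by positivity)]
  nlinarith

lemma tW_mono [Nonempty V] (a : ℕ) (ha : 0 < a) (d : ℕ) :
    tW T a ^ ((1:ℝ)/(a:ℝ)) ≤ tW T (a+2*d) ^ ((1:ℝ)/((a+2*d:ℕ):ℝ)) := by
  induction d with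
  | zero => simp
  | succ d ih =>
    obtain ⟨c, hc⟩ : ∃ c, a + 2*d = c+1 := ⟨a+2*d-1, by omega⟩
    have := tW_step T c
    rw [show a+2*(d+1) = c+1+2 by omega]
    rw [hc] at ih
    exact ih.trans this

end walks

section homs
variable {V : Type*} [Fintype V] (T : SimpleGraph V)

/-- walks of length `a` from `v` as functions. -/
def WS (a : ℕ) (v : V) : Type _ :=
  {f : Fin (a+1) → V // f 0 = v ∧ ∀ i : Fin a, T.Adj (f i.castSucc) (f i.succ)}

instance (a : ℕ) (v : V) : Finite (WS T a v) := by unfold WS; infer_instance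

/-- splitting off the first vertex. -/
def WS_equiv (a : ℕ) (v : V) : WS T (a+1) v ≃ Σ u : {u // T.Adj v u}, WS T a u.1 where
  toFun f := ⟨⟨f.1 1, by have := f.2.2 0; rw [Fin.castSucc_zero, f.2.1] at this; exact this⟩,
    ⟨fun i => f.1 i.succ, rfl, fun i => by
      have := f.2.2 i.succ
      rwa [← Fin.succ_castSucc] at this⟩⟩
  invFun p := ⟨Fin.cons v p.2.1, rfl, fun i => by
      refine Fin.cases ?_ (fun i => ?_) i
      · have := p.1.2
        rw [← p.2.2.1] at this
        simpa using this
      · have := p.2.2.2 i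
        rw [← Fin.succ_castSucc, Fin.cons_succ, Fin.cons_succ]
        exact this⟩
  left_inv f := by
    apply Subtype.ext
    funext i
    refine Fin.cases ?_ (fun i => ?_) i
    · exact f.2.1.symm
    · rfl
  right_inv p := by
    obtain ⟨⟨u, hu⟩, ⟨g, hg, h⟩⟩ := p
    dsimp only at hg
    subst hg
    rfl

lemma card_WS (a : ℕ) : ∀ v, (Nat.card (WS T a v) : ℝ) = wlk T a v := by
  classical
  induction a with
  | zero =>
    intro v
    simp only [wlk]
    have : Nat.card (WS T 0 v) = 1 := by
      rw [Nat.card_eq_one_iff_unique]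
      refine ⟨⟨fun f g => Subtype.ext (funext fun i => ?_)⟩, ⟨⟨fun _ => v, rfl, fun i => i.elim0⟩⟩⟩
      rw [show i = 0 from Fin.ext (by omega), f.2.1, g.2.1]
    simp [this]
  | succ a ih =>
    intro v
    rw [Nat.card_congr (WS_equiv T a v), Nat.card_sigma, wlk_succ]
    push_cast
    simp only [ih]
    rw [← Finset.sum_filter]
    exact (Finset.sum_subtype (Finset.univ.filter (fun u => T.Adj v u)) (by simp) (fun u => wlk T a u)).symm

/-- homomorphisms from the path graph are walks. -/
def hom_equiv (a : ℕ) : (pathGraph (a+1) →g T) ≃ Σ v : V, WS T a v where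
  toFun f := ⟨f 0, ⟨f, rfl, fun i => f.map_rel (by
    rw [pathGraph_adj]; left; simp)⟩⟩
  invFun p := ⟨p.2.1, fun {x y} h => by
    rw [pathGraph_adj] at h
    rcases h with h | h
    · have := p.2.2.2 ⟨x.1, by omega⟩
      have e : y = Fin.succ ⟨x.1, by omega⟩ := Fin.ext (by simp [← h])
      rw [e]; exact this
    · have := p.2.2.2 ⟨y.1, by omega⟩
      have e : x = Fin.succ ⟨y.1, by omega⟩ := Fin.ext (by simp [← h])
      rw [e]; exact this.symm⟩
  left_inv f := by ext; rfl
  right_inv p := by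
    obtain ⟨v, ⟨f, hf, h⟩⟩ := p
    subst hf
    rfl

lemma card_hom (a : ℕ) : (Nat.card (pathGraph (a+1) →g T) : ℝ) = totW T a := by
  rw [Nat.card_congr (hom_equiv T a), Nat.card_sigma, totW]
  push_cast
  simp only [card_WS]

lemma homDensity_path (a : ℕ) : homDensity (pathGraph (a+1)) T = tW T a := by
  rw [homDensity, card_hom, tW, Fintype.card_fin]

lemma homDensity_iso {α β γ : Type*} [Fintype α] [Fintype β] [Fintype γ] (G : SimpleGraph α)
    (T : SimpleGraph β) (S : SimpleGraph γ) (e : T ≃g S) : homDensity G T = homDensity G S := by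
  rw [homDensity, homDensity, Fintype.card_congr e.toEquiv]
  congr 2
  refine Nat.card_congr ⟨fun f => e.toHom.comp f, fun f => e.symm.toHom.comp f, fun f => ?_, fun f => ?_⟩
  · ext x; simp
  · ext x; simp

end homs

lemma upper_mem (k l m : ℕ) (hk : 0 < k) (hl : 0 < l) (hm : 0 < m) (hmk : m ≤ k) :
    (2*(k:ℝ)*(l:ℝ) + 2*(k:ℝ) - 1) / (((l:ℝ) + 1) * (2*(k:ℝ)*(l:ℝ) + 2*(m:ℝ) - 1)) ∈
      domSet (pathGraph (2*k)) (pathGraph (2*k*l + 2*m)) := by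
  have hk1 : (1:ℝ) ≤ k := by exact_mod_cast hk
  have hm1 : (1:ℝ) ≤ m := by exact_mod_cast hm
  have hl1 : (1:ℝ) ≤ l := by exact_mod_cast hl
  have hkl : (0:ℝ) ≤ 2*k*l := by positivity
  refine ⟨div_nonneg (by linarith) (mul_nonneg (by linarith) (by linarith)), ?_⟩
  intro n hn T
  have : Nonempty (Fin n) := ⟨⟨0, hn⟩⟩
  obtain ⟨p, hp⟩ : ∃ p, 2*k = p+1 := ⟨2*k-1, by omega⟩
  obtain ⟨q, hq⟩ : ∃ q, 2*k*l+2*m = q+1 := ⟨2*k*l+2*m-1, by omega⟩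
  rw [hp] at hq ⊢
  rw [hq, homDensity_path, homDensity_path]
  have hq0 : 0 < q := by omega
  have h1 := tW_mono T q hq0 (k-m)
  have h2 := tW_mul T p l
  have e : q + 2*(k-m) = (l+1)*(p+1) - 1 := by
    have : (l+1)*(p+1) = (p+1)*l+(p+1) := by ring
    omega
  rw [e] at h1
  set s := (l+1)*(p+1) - 1 with hs
  have hs0 : 0 < s := by omega
  have hqR : (q:ℝ) = 2*k*l+2*m-1 := by
    have : ((p+1 : ℕ):ℝ)*l+2*m = q+1 := by exact_mod_cast hq
    rw [← hp] at this; push_cast at this; linarith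
  have hsR : (s:ℝ) = 2*k*l+2*k-1 := by
    have h3 : s + 1 = (l+1)*(p+1) := by
      have : 0 < (l+1)*(p+1) := by positivity
      omega
    rw [← hp] at h3
    have : (s:ℝ)+1 = (l+1)*(2*k) := by exact_mod_cast h3
    linarith
  rw [← hqR, ← hsR]
  have hqp : (0:ℝ) < q := by exact_mod_cast hq0
  have hsp : (0:ℝ) < s := by exact_mod_cast hs0
  calc tW T q ^ ((s:ℝ) / ((l+1)*q)) = (tW T q ^ ((1:ℝ)/q)) ^ ((s:ℝ)/(l+1)) := by
        rw [← Real.rpow_mul (tW_nonneg T q)]; congr 1; field_simp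
    _ ≤ (tW T s ^ ((1:ℝ)/s)) ^ ((s:ℝ)/(l+1)) :=
        Real.rpow_le_rpow (Real.rpow_nonneg (tW_nonneg T q) _) h1 (by positivity)
    _ = tW T s ^ ((1:ℝ)/(l+1)) := by
        rw [← Real.rpow_mul (tW_nonneg T s)]; congr 1; field_simp
    _ ≤ (tW T p ^ (l+1)) ^ ((1:ℝ)/(l+1)) :=
        Real.rpow_le_rpow (tW_nonneg T s) h2 (by positivity)
    _ = tW T p := by
        rw [← Real.rpow_natCast, ← Real.rpow_mul (tW_nonneg T p)]
        push_cast
        rw [mul_one_div_cancel (by positivity), Real.rpow_one]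

/-- exponents of class sizes. -/
def al (k l c : ℕ) : ℕ := if c % 2 = 0 then (c/2 + k - 1)/k else l - (c/2)/k

lemma al_le (k l m c : ℕ) (hk : 0 < k) (hmk : m ≤ k) (hc : c < 2*(k*l+m)) : al k l c ≤ l+1 := by
  unfold al
  split_ifs
  · apply Nat.le_of_lt_succ
    rw [Nat.div_lt_iff_lt_mul hk]
    have : (l+1+1)*k = k*l+2*k := by ring
    show _ < (l+1+1)*k
    omega
  · exact (Nat.sub_le _ _).trans (Nat.le_succ l)

lemma al_edge (k l m c : ℕ) (hk : 0 < k) (hmk : m ≤ k) (hc : c + 1 < 2*(k*l+m)) :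
    al k l c + al k l (c+1) = l ∨ al k l c + al k l (c+1) = l+1 := by
  unfold al
  rcases Nat.even_or_odd' c with ⟨j, rfl | rfl⟩
  · have h1 : (2*j+1)/2 = j := by omega
    have h2 : (2*j)/2 = j := by omega
    have h3 : (2*j)%2 = 0 := by omega
    have h4 : ¬ (2*j+1)%2 = 0 := by omega
    rw [if_pos h3, if_neg h4, h1, h2]
    have h5 : j/k ≤ l := by
      apply Nat.le_of_lt_succ
      rw [Nat.div_lt_iff_lt_mul hk]
      have : (l+1)*k = k*l+k := by ring
      show _ < (l+1)*k
      omega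
    have h6 : j/k ≤ (j+k-1)/k := Nat.div_le_div_right (by omega)
    have h7 : (j+k-1)/k ≤ j/k+1 := by
      rw [← Nat.add_div_right j hk]
      exact Nat.div_le_div_right (by omega)
    omega
  · have h1 : (2*j+1)/2 = j := by omega
    have h2 : (2*j+1+1)/2 = j+1 := by omega
    have h3 : (2*j+1+1)%2 = 0 := by omega
    have h4 : ¬ (2*j+1)%2 = 0 := by omega
    rw [if_pos h3, if_neg h4, h1, h2]
    have h5 : j/k ≤ l := by
      apply Nat.le_of_lt_succ
      rw [Nat.div_lt_iff_lt_mul hk]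
      have : (l+1)*k = k*l+k := by ring
      show _ < (l+1)*k
      omega
    have h6 : (j+1+k-1)/k = j/k+1 := by
      rw [← Nat.add_div_right j hk]
      congr 1
      omega
    omega

lemma al_far_aux (k l i j : ℕ) (hk : 0 < k) (h : i + 1 ≤ j + k) :
    l ≤ al k l (2*j) + al k l (2*i+1) := by
  unfold al
  have h1 : (2*i+1)/2 = i := by omega
  have h2 : (2*j)/2 = j := by omega
  have h3 : (2*j)%2 = 0 := by omega
  have h4 : ¬ (2*i+1)%2 = 0 := by omega
  rw [if_pos h3, if_neg h4, h1, h2]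
  have h6 : i/k ≤ (j+k-1)/k := Nat.div_le_div_right (by omega)
  omega

lemma al_far (k l c d : ℕ) (hk : 0 < k) (h : (c + d) % 2 = 1) (h1 : c < d + 2*k) (h2 : d < c + 2*k) :
    l ≤ al k l c + al k l d := by
  rcases Nat.even_or_odd' c with ⟨j, rfl | rfl⟩ <;> rcases Nat.even_or_odd' d with ⟨i, rfl | rfl⟩
  · omega
  · exact al_far_aux k l i j hk (by omega)
  · rw [add_comm]; exact al_far_aux k l j i hk (by omega)
  · omega

/-- adjacency of classes -/
def cadj (c d : ℕ) : Prop := c + 1 = d ∨ d + 1 = c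

instance (c d : ℕ) : Decidable (cadj c d) := by unfold cadj; infer_instance

/-- vertex type of the extremal graph -/
abbrev VV (k l C r : ℕ) : Type := Σ c : Fin C, Fin (r^(2*(l+1-al k l c))) × Fin r

/-- The extremal graph -/
def TT (k l C r : ℕ) : SimpleGraph (VV k l C r) where
  Adj x y := cadj x.1 y.1 ∧ (al k l x.1 + al k l y.1 = l → x.2.2 = y.2.2)
  symm := ⟨fun x y h => ⟨by rcases h.1 with h | h; exacts [Or.inr h, Or.inl h],
    fun e => (h.2 (by rw [add_comm]; exact e)).symm⟩⟩
  loopless := ⟨fun x h => by rcases h.1 with h | h <;> omega⟩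

instance (k l C r : ℕ) : DecidableRel (TT k l C r).Adj := fun x y => by
  unfold TT; infer_instance

/-- class walk weights -/
noncomputable def gg (k l C r : ℕ) : ℕ → Fin C → ℝ
  | 0, c => ((r:ℝ)^(al k l c))⁻¹
  | (a+1), c => ∑ d : Fin C, if cadj c d then gg k l C r a d else 0

lemma gg_nonneg (k l C r a : ℕ) : ∀ c, 0 ≤ gg k l C r a c := by
  induction a with
  | zero => intro c; simp only [gg]; positivity
  | succ a ih =>
    intro c
    simp only [gg]
    exact Finset.sum_nonneg fun u _ => by split_ifs; exacts [ih u, le_rfl]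

lemma deg_class (k l m r : ℕ) (hk : 0 < k) (hmk : m ≤ k) (hr : 0 < r) (x : VV k l (2*(k*l+m)) r)
    (d : Fin (2*(k*l+m))) (h : cadj x.1 d) :
    (∑ y : Fin (r^(2*(l+1-al k l d))) × Fin r, if (TT k l _ r).Adj x ⟨d, y⟩ then (1:ℝ) else 0)
      = (r:ℝ)^(l+2) * r^(al k l x.1) * ((r:ℝ)^(al k l d))⁻¹ := by
  have hd := al_le k l m d hk hmk d.2
  have hR : (r:ℝ) ≠ 0 := by positivity
  have hcases : al k l x.1 + al k l d = l ∨ al k l x.1 + al k l d = l+1 := by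
    rcases h with h | h
    · rw [← h]; exact al_edge k l m _ hk hmk (by rw [h]; exact d.2)
    · rw [← h, add_comm]; exact al_edge k l m _ hk hmk (by rw [h]; exact x.1.2)
  obtain ⟨e, he⟩ : ∃ e, l + 1 = al k l d + e := ⟨l+1-al k l d, by omega⟩
  have he2 : l + 1 - al k l d = e := by omega
  rw [eq_mul_inv_iff_mul_eq₀ (by positivity), Fintype.sum_prod_type]
  have hadj : ∀ y, (TT k l _ r).Adj x ⟨d, y⟩ ↔ (al k l x.1 + al k l d = l → x.2.2 = y.2) := by
    intro y
    exact ⟨fun t => t.2, fun t => ⟨h, t⟩⟩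
  simp only [hadj]
  rcases hcases with hc | hc
  · simp only [hc, true_imp_iff, Finset.sum_ite_eq, Finset.mem_univ, if_true, Finset.sum_const,
      Finset.card_univ, Fintype.card_fin, nsmul_eq_mul, mul_one]
    rw [he2]
    push_cast
    rw [← pow_add, ← pow_add]
    congr 1
    omega
  · have : ¬ (al k l x.1 + al k l d = l) := by omega
    simp only [this, false_imp_iff, if_true, Finset.sum_const,
      Finset.card_univ, Fintype.card_fin, nsmul_eq_mul, mul_one]
    rw [he2]
    push_cast
    rw [← pow_succ, ← pow_add, ← pow_add]
    congr 1
    omega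

lemma wlk_TT (k l m r : ℕ) (hk : 0 < k) (hmk : m ≤ k) (hr : 0 < r) (a : ℕ) :
    ∀ x : VV k l (2*(k*l+m)) r, wlk (TT k l _ r) a x =
      ((r:ℝ)^(l+2))^a * r^(al k l x.1) * gg k l _ r a x.1 := by
  have hR : (r:ℝ) ≠ 0 := by positivity
  induction a with
  | zero => intro x; simp only [wlk, gg]; field_simp
  | succ a ih =>
    intro x
    have e : wlk (TT k l (2*(k*l+m)) r) (a+1) x =
        ∑ y, if (TT k l (2*(k*l+m)) r).Adj x y then wlk (TT k l (2*(k*l+m)) r) a y else 0 := by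
      rw [wlk_succ]
      exact Finset.sum_congr rfl fun y _ => by congr
    rw [e, Fintype.sum_sigma]
    simp only [gg]
    rw [Finset.mul_sum]
    refine Finset.sum_congr rfl fun d _ => ?_
    simp only [ih]
    by_cases h : cadj x.1 d
    · rw [if_pos h]
      have := deg_class k l m r hk hmk hr x d h
      have e2 : (∑ y : Fin (r^(2*(l+1-al k l d))) × Fin r, if (TT k l _ r).Adj x ⟨d, y⟩ then
          ((r:ℝ)^(l+2))^a * r^(al k l d) * gg k l _ r a d else 0) =
          (∑ y : Fin (r^(2*(l+1-al k l d))) × Fin r, if (TT k l _ r).Adj x ⟨d, y⟩ then (1:ℝ) else 0)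
          * (((r:ℝ)^(l+2))^a * r^(al k l d) * gg k l _ r a d) := by
        rw [Finset.sum_mul]
        exact Finset.sum_congr rfl fun y _ => by split_ifs <;> simp
      rw [e2, this, pow_succ _ a]
      field_simp
    · rw [if_neg h, mul_zero]
      refine Finset.sum_eq_zero fun y _ => ?_
      rw [if_neg fun t => h t.1]

lemma totW_TT (k l m r : ℕ) (hk : 0 < k) (hmk : m ≤ k) (hr : 0 < r) (a : ℕ) :
    totW (TT k l (2*(k*l+m)) r) a =
      (r:ℝ)^(2*l+3) * ((r:ℝ)^(l+2))^a * ∑ c, gg k l (2*(k*l+m)) r a c * ((r:ℝ)^(al k l c))⁻¹ := by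
  have hR : (r:ℝ) ≠ 0 := by positivity
  rw [totW, Fintype.sum_sigma, Finset.mul_sum]
  refine Finset.sum_congr rfl fun d _ => ?_
  simp only [wlk_TT k l m r hk hmk hr]
  have hd := al_le k l m d hk hmk d.2
  obtain ⟨e, he⟩ : ∃ e, l + 1 = al k l d + e := ⟨l+1-al k l d, by omega⟩
  have he2 : l + 1 - al k l d = e := by omega
  simp only [Finset.sum_const, Finset.card_univ, Fintype.card_prod, Fintype.card_fin, nsmul_eq_mul]
  rw [he2, show 2*l+3 = 2*e + 1 + al k l d + al k l d by omega]
  push_cast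
  rw [pow_add _ _ (al k l d), pow_add _ _ (al k l d), pow_succ]
  field_simp
  ring

lemma gg_le (k l C r : ℕ) (K : ℝ) (a : ℕ) : ∀ c : Fin C,
    (∀ d : Fin C, (c.1 + d.1 + a) % 2 = 0 → c.1 ≤ d.1 + a → d.1 ≤ c.1 + a → ((r:ℝ)^(al k l d))⁻¹ ≤ K) →
    0 ≤ K → gg k l C r a c ≤ (C:ℝ)^a * K := by
  induction a with
  | zero =>
    intro c h _
    simpa [gg] using h c (by omega) (by omega) (by omega)
  | succ a ih =>
    intro c h hK
    simp only [gg]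
    have : (C:ℝ)^(a+1)*K = ∑ d : Fin C, (C:ℝ)^a*K := by
      simp; ring
    rw [this]
    refine Finset.sum_le_sum fun d _ => ?_
    split_ifs with hcd
    · refine ih d (fun e h1 h2 h3 => h e ?_ ?_ ?_) hK <;> rcases hcd with hcd | hcd <;> omega
    · positivity

lemma gg_ge (k l C r : ℕ) (L : ℕ) (hC : C = L+1) (h0 : al k l L = 0) (a : ℕ) :
    ∀ c : Fin C, c.1 + a = L → 1 ≤ gg k l C r a c := by
  induction a with
  | zero =>
    intro c h
    rw [add_zero] at h
    simp [gg, h, h0]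
  | succ a ih =>
    intro c h
    simp only [gg]
    have h1 := ih ⟨c.1+1, by omega⟩ (by simp only; omega)
    refine le_trans ?_ (Finset.single_le_sum (f := fun d : Fin C => if cadj c d then gg k l C r a d else 0)
      (fun x _ => ?_) (Finset.mem_univ ⟨c.1+1, by omega⟩))
    · simp only
      rw [if_pos (show cadj c.1 (c.1+1) from Or.inl rfl)]; exact h1
    · split_ifs; exacts [gg_nonneg k l C r a x, le_rfl]

lemma card_VV_le (k l C r : ℕ) (hr : 0 < r) : Fintype.card (VV k l C r) ≤ C * r^(2*l+3) := by
  rw [Fintype.card_sigma]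
  refine (Finset.sum_le_card_nsmul _ _ (r^(2*l+3)) fun c _ => ?_).trans (by simp)
  simp only [Fintype.card_prod, Fintype.card_fin]
  rw [← pow_succ]
  exact Nat.pow_le_pow_right hr (by omega)

lemma le_card_VV (k l C r : ℕ) (hC : 0 < C) (hk : 0 < k) : r^(2*l+3) ≤ Fintype.card (VV k l C r) := by
  rw [Fintype.card_sigma]
  refine le_trans ?_ (Finset.single_le_sum (fun x _ => Nat.zero_le _) (Finset.mem_univ (⟨0, hC⟩ : Fin C)))
  have : al k l 0 = 0 := by
    simp only [al, Nat.zero_mod, if_true, Nat.zero_div]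
    exact Nat.div_eq_of_lt (by omega)
  simp only [Fintype.card_prod, Fintype.card_fin, this]
  rw [← pow_succ]
  exact le_of_eq (by congr 1)

lemma tW_TT_lower (k l m r : ℕ) (hk : 0 < k) (hm : 0 < m) (hmk : m ≤ k) (hr : 0 < r) (L : ℕ)
    (hL : 2*(k*l+m) = L+1) :
    ((L+1 : ℕ) : ℝ)⁻¹^(L+1) * ((r:ℝ)^((l+1)*L))⁻¹ ≤ tW (TT k l (2*(k*l+m)) r) L := by
  have hR : (0:ℝ) < r := by exact_mod_cast hr
  have h1 := card_VV_le k l (2*(k*l+m)) r hr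
  have h2 := le_card_VV k l (2*(k*l+m)) r (by omega) hk
  have hpos : 0 < Fintype.card (VV k l (2*(k*l+m)) r) := lt_of_lt_of_le (by positivity) h2
  have h1' : (Fintype.card (VV k l (2*(k*l+m)) r) : ℝ) ≤ ((L+1:ℕ):ℝ) * (r:ℝ)^(2*l+3) := by
    rw [← hL]; exact_mod_cast h1
  have hposR : (0:ℝ) < Fintype.card (VV k l (2*(k*l+m)) r) := by exact_mod_cast hpos
  have alL : al k l L = 0 := by
    unfold al
    rw [if_neg (by omega)]
    have : l ≤ L/2/k := by
      rw [Nat.le_div_iff_mul_le hk, mul_comm]; omega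
    omega
  have al0 : al k l 0 = 0 := by
    simp only [al, Nat.zero_mod, if_true, Nat.zero_div]
    exact Nat.div_eq_of_lt (by omega)
  have hg : 1 ≤ ∑ c, gg k l (2*(k*l+m)) r L c * ((r:ℝ)^(al k l c))⁻¹ := by
    refine le_trans ?_ (Finset.single_le_sum (f := fun c : Fin (2*(k*l+m)) =>
      gg k l (2*(k*l+m)) r L c * ((r:ℝ)^(al k l c))⁻¹) (fun x _ => ?_)
      (Finset.mem_univ ⟨0, by omega⟩))
    · simp only [al0, pow_zero, inv_one, mul_one]
      exact gg_ge k l _ r L hL alL L _ (by simp)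
    · exact mul_nonneg (gg_nonneg _ _ _ _ _ _) (by positivity)
  rw [tW, totW_TT k l m r hk hmk hr, le_div_iff₀ (by positivity)]
  calc ((L+1 : ℕ) : ℝ)⁻¹^(L+1) * ((r:ℝ)^((l+1)*L))⁻¹ * (Fintype.card (VV k l (2*(k*l+m)) r) : ℝ)^(L+1)
      ≤ ((L+1 : ℕ) : ℝ)⁻¹^(L+1) * ((r:ℝ)^((l+1)*L))⁻¹ * (((L+1:ℕ):ℝ) * (r:ℝ)^(2*l+3))^(L+1) := by
        gcongr
    _ = (r:ℝ)^(2*l+3) * ((r:ℝ)^(l+2))^L * 1 := by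
        rw [mul_pow, pow_succ ((r:ℝ)^(2*l+3)), show 2*l+3 = (l+1)+(l+2) by ring, pow_add _ (l+1) (l+2),
          mul_pow _ _ L, ← pow_mul _ (l+1) L, inv_pow]
        have : ((L+1:ℕ):ℝ) ≠ 0 := by positivity
        field_simp
    _ ≤ _ := mul_le_mul_of_nonneg_left hg (by positivity)

lemma tW_TT_upper (k l m r : ℕ) (hk : 0 < k) (hm : 0 < m) (hmk : m ≤ k) (hr : 0 < r) (p : ℕ)
    (hp : 2*k = p+1) :
    tW (TT k l (2*(k*l+m)) r) p ≤ ((2*(k*l+m) : ℕ) : ℝ)^(p+1) * ((r:ℝ)^((l+1)*p+l))⁻¹ := by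
  have hR : (0:ℝ) < r := by exact_mod_cast hr
  have h2 := le_card_VV k l (2*(k*l+m)) r (by omega) hk
  have h2' : (r:ℝ)^(2*l+3) ≤ (Fintype.card (VV k l (2*(k*l+m)) r) : ℝ) := by exact_mod_cast h2
  have hposR : (0:ℝ) < Fintype.card (VV k l (2*(k*l+m)) r) := lt_of_lt_of_le (by positivity) h2'
  set C := 2*(k*l+m) with hC
  have hg : ∑ c, gg k l C r p c * ((r:ℝ)^(al k l c))⁻¹ ≤ (C:ℝ)^(p+1) * ((r:ℝ)^l)⁻¹ := by
    have : (C:ℝ)^(p+1) * ((r:ℝ)^l)⁻¹ = ∑ c : Fin C, (C:ℝ)^p * ((r:ℝ)^l)⁻¹ := by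
      simp; ring
    rw [this]
    refine Finset.sum_le_sum fun c _ => ?_
    have hb := gg_le k l C r ((r:ℝ)^(al k l c) * ((r:ℝ)^l)⁻¹) p c (fun d h1 h3 h4 => ?_) (by positivity)
    · calc _ ≤ (C:ℝ)^p * ((r:ℝ)^(al k l c) * ((r:ℝ)^l)⁻¹) * ((r:ℝ)^(al k l c))⁻¹ := by gcongr
        _ = _ := by field_simp
    · have hf := al_far k l c d hk (by omega) (by omega) (by omega)
      rw [← div_eq_mul_inv, le_div_iff₀ (by positivity), inv_mul_le_iff₀ (by positivity), ← pow_add]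
      refine pow_le_pow_right₀ (by exact_mod_cast hr) (by omega)
  rw [tW, totW_TT k l m r hk hmk hr, div_le_iff₀ (by positivity)]
  calc _ ≤ (r:ℝ)^(2*l+3) * ((r:ℝ)^(l+2))^p * ((C:ℝ)^(p+1) * ((r:ℝ)^l)⁻¹) :=
        mul_le_mul_of_nonneg_left hg (by positivity)
    _ = (C:ℝ)^(p+1) * ((r:ℝ)^((l+1)*p+l))⁻¹ * ((r:ℝ)^(2*l+3))^(p+1) := by
        rw [pow_succ ((r:ℝ)^(2*l+3)), show 2*l+3 = (l+1)+(l+2) by ring, pow_add _ (l+1) (l+2),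
          mul_pow _ _ p, ← pow_mul _ (l+1) p, pow_add _ ((l+1)*p) l]
        field_simp
    _ ≤ _ := by gcongr

lemma lower_bd (k l m : ℕ) (hk : 0 < k) (hm : 0 < m) (hmk : m ≤ k) (c : ℝ)
    (hc : c ∈ domSet (pathGraph (2*k)) (pathGraph (2*k*l + 2*m))) :
    (2*(k:ℝ)*(l:ℝ) + 2*(k:ℝ) - 1) / (((l:ℝ) + 1) * (2*(k:ℝ)*(l:ℝ) + 2*(m:ℝ) - 1)) ≤ c := by
  obtain ⟨hc0, hc⟩ := hc
  have hk1 : (1:ℝ) ≤ k := by exact_mod_cast hk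
  have hm1 : (1:ℝ) ≤ m := by exact_mod_cast hm
  have hkl : (0:ℝ) ≤ 2*k*l := by positivity
  obtain ⟨p, hp⟩ : ∃ p, 2*k = p+1 := ⟨2*k-1, by omega⟩
  obtain ⟨L, hL⟩ : ∃ L, 2*(k*l+m) = L+1 := ⟨2*(k*l+m)-1, by omega⟩
  have hL' : 2*k*l+2*m = L+1 := by rw [← hL]; ring
  have hpR : (p:ℝ) = 2*k-1 := by
    have : 2*(k:ℝ) = p+1 := by exact_mod_cast hp
    linarith
  have hLR : (L:ℝ) = 2*k*l+2*m-1 := by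
    have : 2*(k:ℝ)*l+2*m = L+1 := by exact_mod_cast hL'
    linarith
  rw [← hLR, show 2*(k:ℝ)*l+2*k-1 = (l+1)*p+l by rw [hpR]; ring]
  have hLp : (0:ℝ) < L := by rw [hLR]; linarith
  rw [div_le_iff₀ (by positivity)]
  by_contra hcon
  push Not at hcon
  -- inequality for every `r`
  have key : ∀ r : ℕ, 0 < r →
      (r:ℝ)^(((l:ℝ)+1)*p+l - c*((l+1)*L)) ≤
        ((L+1 : ℕ):ℝ)^(p+1) / (((L+1 : ℕ) : ℝ)⁻¹^(L+1))^c := by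
    intro r hr
    have hR : (0:ℝ) < r := by exact_mod_cast hr
    set n := Fintype.card (VV k l (2*(k*l+m)) r) with hn
    have hpos : 0 < n := lt_of_lt_of_le (by positivity) (le_card_VV k l (2*(k*l+m)) r (by omega) hk)
    let e := Fintype.equivFin (VV k l (2*(k*l+m)) r)
    let S : SimpleGraph (Fin n) := (TT k l (2*(k*l+m)) r).map e.toEmbedding
    have iso : TT k l (2*(k*l+m)) r ≃g S := SimpleGraph.Iso.map e _
    have h := hc n hpos S
    rw [← homDensity_iso _ _ _ iso, ← homDensity_iso _ _ _ iso, hL', hp, homDensity_path,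
      homDensity_path] at h
    have h1 := tW_TT_lower k l m r hk hm hmk hr L hL
    have h2 := tW_TT_upper k l m r hk hm hmk hr p hp
    have h3 := ((Real.rpow_le_rpow (by positivity) h1 hc0).trans h).trans h2
    rw [Real.mul_rpow (by positivity) (by positivity), hL] at h3
    rw [le_div_iff₀ (by positivity), Real.rpow_sub hR]
    have e1 : (r:ℝ)^(((l:ℝ)+1)*p+l) = (r:ℝ)^((l+1)*p+l) := by
      rw [← Real.rpow_natCast]; push_cast; rfl
    have e2 : (((r:ℝ)^((l+1)*L))⁻¹)^c = ((r:ℝ)^(c*(((l:ℝ)+1)*L)))⁻¹ := by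
      rw [Real.inv_rpow (by positivity), ← Real.rpow_natCast, ← Real.rpow_mul hR.le]
      push_cast
      rw [mul_comm c]
    rw [e2] at h3
    rw [e1]
    have hx : (0:ℝ) < (r:ℝ)^((l+1)*p+l) := by positivity
    have h4 := mul_le_mul_of_nonneg_left h3 hx.le
    calc _ = (r:ℝ)^((l+1)*p+l) * ((((L+1 : ℕ) : ℝ)⁻¹^(L+1))^c * ((r:ℝ)^(c*(((l:ℝ)+1)*L)))⁻¹) := by
          rw [div_eq_mul_inv]; ring
      _ ≤ _ := h4
      _ = _ := by field_simp
  have hpow : 0 < ((l:ℝ)+1)*p+l - c*((l+1)*L) := by linarith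
  have ht := (tendsto_rpow_atTop hpow).comp (tendsto_natCast_atTop_atTop (R := ℝ))
  obtain ⟨r, hr1, hr2⟩ := ((ht.eventually_gt_atTop (((L+1 : ℕ):ℝ)^(p+1) / (((L+1 : ℕ) : ℝ)⁻¹^(L+1))^c)).and
    (Filter.eventually_gt_atTop 0)).exists
  exact absurd (key r hr2) (not_le.mpr hr1)

theorem stmt_5 (k l m : ℕ) (hk : 0 < k) (hl : 0 < l) (hm : 0 < m) (hmk : m ≤ k) :
    domExp (pathGraph (2*k)) (pathGraph (2*k*l + 2*m)) =
      (2*(k:ℝ)*(l:ℝ) + 2*(k:ℝ) - 1) / (((l:ℝ) + 1) * (2*(k:ℝ)*(l:ℝ) + 2*(m:ℝ) - 1)) :=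
  IsLeast.csInf_eq ⟨upper_mem k l m hk hl hm hmk, fun c hc => lower_bd k l m hk hm hmk c hc⟩
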